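/- arXiv:2004.08450 — 2 statements merged into one kernel-verified Lean document; each statement's English description precedes it below -/
import Mathlib

section
/- Semantic soundness of the reduction to reachability: Let Σ be the state space of a deterministic object with method set M and step function step, and fix two methods m, n with argument types X, Y and step functions step_m, step_n. For σ : Σ, x : X, y : Y write (σ_m, r_m) = step_m x σ, (σ_mn, r_mn) = step_n y σ_m, (σ_n, r_n) = step_n y σ, (σ_nm, r_nm) = step_m x σ_n. Let I : Σ → Σ → Prop be a relation such that whenever I σ₁ σ₂, for every method k : M and every argument a : Arg k, the return values of step k a at σ₁ and at σ₂ are equal and I holds of the resulting post-states. Let φ : Σ → X → Y → Prop satisfy: for all σ, x, y with φ σ x y, r_m = r_nm, r_n = r_mn, and I σ_mn σ_nm. Then φ is a commutativity condition for m and n: for all σ, x, y with φ σ x y, the return values of the two execution orders agree (r_m = r_nm and r_n = r_mn) and σ_mn ≃ σ_nm. -/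
/-- Running a finite list of actions from a state, producing the final state
and the list of return values observed. -/
def run {S M : Type} {Arg Ret : M → Type}
    (step : ∀ m : M, Arg m → S → S × Ret m) :
    S → List ((m : M) × Arg m) → S × List ((m : M) × Ret m)
  | σ, [] => (σ, [])
  | σ, ⟨m, a⟩ :: rest =>
    let p := step m a σ
    let q := run step p.1 rest
    (q.1, ⟨m, p.2⟩ :: q.2)

/-- Observational equivalence: every finite list of actions produces equal
lists of return values from both states. -/
def ObsEq {S M : Type} {Arg Ret : M → Type}
    (step : ∀ m : M, Arg m → S → S × Ret m) (σ₁ σ₂ : S) : Prop :=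
  ∀ acts : List ((m : M) × Arg m), (run step σ₁ acts).2 = (run step σ₂ acts).2

/-- States related by a bisimulation are observationally equivalent. -/
theorem obsEq_of_bisimulation {S M : Type} {Arg Ret : M → Type}
    (step : ∀ m : M, Arg m → S → S × Ret m) (I : S → S → Prop)
    (hI : ∀ σ₁ σ₂ : S, I σ₁ σ₂ →
        ∀ (k : M) (a : Arg k),
          (step k a σ₁).2 = (step k a σ₂).2 ∧
          I (step k a σ₁).1 (step k a σ₂).1)
    {σ₁ σ₂ : S} (h : I σ₁ σ₂) : ObsEq step σ₁ σ₂ := by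
  intro acts
  induction acts generalizing σ₁ σ₂ with
  | nil => rfl
  | cons act rest ih =>
    obtain ⟨k, a⟩ := act
    obtain ⟨hret, hpost⟩ := hI σ₁ σ₂ h k a
    simp only [run, hret, ih hpost]

/-- Semantic soundness of the reduction to reachability. -/
theorem reduction_soundness
    {S M : Type} {Arg Ret : M → Type}
    (step : ∀ m : M, Arg m → S → S × Ret m)
    (m n : M)
    (I : S → S → Prop)
    -- I is preserved by every method, with equal return values
    (hI : ∀ σ₁ σ₂ : S, I σ₁ σ₂ →
        ∀ (k : M) (a : Arg k),
          (step k a σ₁).2 = (step k a σ₂).2 ∧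
          I (step k a σ₁).1 (step k a σ₂).1)
    (φ : S → Arg m → Arg n → Prop)
    -- whenever φ holds, return values agree and I holds of the two post-states
    (hφ : ∀ (σ : S) (x : Arg m) (y : Arg n), φ σ x y →
        (step m x σ).2 = (step m x (step n y σ).1).2 ∧
        (step n y σ).2 = (step n y (step m x σ).1).2 ∧
        I (step n y (step m x σ).1).1 (step m x (step n y σ).1).1) :
    -- φ is a commutativity condition for m and n
    ∀ (σ : S) (x : Arg m) (y : Arg n), φ σ x y →
      (step m x σ).2 = (step m x (step n y σ).1).2 ∧
      (step n y σ).2 = (step n y (step m x σ).1).2 ∧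
      ObsEq step (step n y (step m x σ).1).1 (step m x (step n y σ).1).1 := by
  intro σ x y h
  obtain ⟨hm, hn, hpost⟩ := hφ σ x y h
  exact ⟨hm, hn, obsEq_of_bisimulation step I hI hpost⟩
end

section
/- Commutativity condition for ArrayStack push/pop: Fix a capacity MAX : ℤ with MAX ≥ 1. For every ArrayStack state (A, top) and every x : ℤ satisfying 0 ≤ top ∧ top < MAX - 1 ∧ A top = x, the operations push(x) and pop() commute from (A, top): push returns true in both execution orders, pop returns x in both execution orders, and the two final states (A₁, top₁) (from push then pop) and (A₂, top₂) (from pop then push) satisfy top₁ = top₂ and A₁ i = A₂ i for every i with 0 ≤ i ≤ top₁ (the relation I_AS, which implies observational equivalence). -/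
/-- ArrayStack state: an array A : ℤ → ℤ and a top index. -/
abbrev ASState := (ℤ → ℤ) × ℤ

/-- push(x): if top = MAX - 1, return false; otherwise increment top,
write x at the new top, and return true. -/
def asPush (MAX : ℤ) (x : ℤ) (s : ASState) : ASState × Bool :=
  if s.2 = MAX - 1 then (s, false)
  else (((fun i => if i = s.2 + 1 then x else s.1 i), s.2 + 1), true)

/-- pop(): if top = -1, return -1; otherwise return A top and decrement top. -/
def asPop (s : ASState) : ASState × ℤ :=
  if s.2 = -1 then (s, -1) else ((s.1, s.2 - 1), s.1 s.2)

/-- Commutativity condition for ArrayStack push/pop. -/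
theorem arrayStack_push_pop_commute
    (MAX : ℤ) (hMAX : MAX ≥ 1) (A : ℤ → ℤ) (top : ℤ) (x : ℤ)
    (hφ : 0 ≤ top ∧ top < MAX - 1 ∧ A top = x) :
    -- push returns true in both execution orders
    (asPush MAX x (A, top)).2 = true ∧
    (asPush MAX x (asPop (A, top)).1).2 = true ∧
    -- pop returns x in both execution orders
    (asPop (A, top)).2 = x ∧
    (asPop (asPush MAX x (A, top)).1).2 = x ∧
    -- the two final states are related by I_AS
    (asPop (asPush MAX x (A, top)).1).1.2 = (asPush MAX x (asPop (A, top)).1).1.2 ∧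
    (∀ i : ℤ, 0 ≤ i → i ≤ (asPop (asPush MAX x (A, top)).1).1.2 →
      (asPop (asPush MAX x (A, top)).1).1.1 i =
      (asPush MAX x (asPop (A, top)).1).1.1 i) := by
  obtain ⟨h0, h1, rfl⟩ := hφ
  have hpush : asPush MAX (A top) (A, top) =
      ((fun i => if i = top + 1 then A top else A i, top + 1), true) :=
    if_neg (by dsimp only; omega)
  have hpop : asPop (A, top) = ((A, top - 1), A top) :=
    if_neg (by dsimp only; omega)
  have hpushPop : asPop (fun i => if i = top + 1 then A top else A i, top + 1) =
      ((fun i => if i = top + 1 then A top else A i, top), A top) := by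
    have h : top + 1 ≠ -1 := by omega
    simp [asPop, h]
  have hpopPush : asPush MAX (A top) (A, top - 1) =
      ((fun i => if i = top then A top else A i, top), true) := by
    have h : top - 1 ≠ MAX - 1 := by omega
    simp only [asPush, h, if_false, sub_add_cancel]
  rw [hpush, hpop, hpushPop, hpopPush]
  refine ⟨rfl, rfl, rfl, rfl, rfl, fun i _ hi => ?_⟩
  dsimp only at hi ⊢
  grind
end
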